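/- Fix n ≥ 2 and for m ≥ n + 1 define d(m) by the equation L^n_m = (2^{m−n−1} − d(m))·(n − 1) + 1, i.e., d(m) = 2^{m−n−1} − (L^n_m − 1)/(n − 1). Then 0 ≤ d(m) < m·2^{m−2n} for every m ≥ n + 1. Equivalently, 2^{m−n−1}(n−1) + 1 − m·2^{m−2n}(n−1) < L^n_m ≤ 2^{m−n−1}(n−1) + 1 for every m ≥ n + 1. -/

import Mathlib

/-- `keithList a m` is the list of the first `m` terms `K^N_1, …, K^N_m` of the Keith
sequence associated with the digit string `a = [a_1, …, a_n]` (most significant first):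
`K^N_m = a_m` for `1 ≤ m ≤ n` and `K^N_m = K^N_{m-1} + ⋯ + K^N_{m-n}` for `m > n`. -/
def keithList (a : List ℕ) : ℕ → List ℕ
  | 0 => []
  | m + 1 =>
      let prev := keithList a m
      prev ++ [if m < a.length then a.getD m 0 else (prev.drop (m - a.length)).sum]

/-- `keithSeq a m = K^N_m` (1-indexed; `keithSeq a 0 = 0` by convention). -/
def keithSeq (a : List ℕ) (m : ℕ) : ℕ := (keithList a m).getD (m - 1) 0

theorem keithList_succ (a : List ℕ) (m : ℕ) :
    keithList a (m + 1) = keithList a m ++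
      [if m < a.length then a.getD m 0 else ((keithList a m).drop (m - a.length)).sum] :=
  rfl

theorem length_keithList (a : List ℕ) (m : ℕ) : (keithList a m).length = m := by
  induction m with
  | zero => rfl
  | succ m ih => simp [keithList_succ, ih]

theorem keithSeq_succ (a : List ℕ) (m : ℕ) :
    keithSeq a (m + 1) =
      if m < a.length then a.getD m 0 else ((keithList a m).drop (m - a.length)).sum := by
  rw [keithSeq, keithList_succ, List.getD_append_right _ _ _ _ (by simp [length_keithList])]
  simp [length_keithList]

theorem keithList_succ_eq_append_keithSeq (a : List ℕ) (m : ℕ) :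
    keithList a (m + 1) = keithList a m ++ [keithSeq a (m + 1)] := by
  rw [keithSeq_succ, keithList_succ]

theorem getD_keithList (a : List ℕ) {m i : ℕ} (h : i < m) :
    (keithList a m).getD i 0 = keithSeq a (i + 1) := by
  induction m with
  | zero => omega
  | succ m ih =>
    rcases Nat.lt_succ_iff_lt_or_eq.mp h with h | rfl
    · rw [keithList_succ, List.getD_append _ _ _ _ (by simpa [length_keithList]), ih h]
    · rfl

theorem keithList_eq_take (a : List ℕ) {m : ℕ} (h : m ≤ a.length) :
    keithList a m = a.take m := by
  induction m with
  | zero => simp [keithList]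
  | succ m ih =>
    rw [keithList_succ, ih (by omega), if_pos (by omega), List.take_add_one]
    simp [List.getElem?_eq_getElem (show m < a.length by omega)]

theorem keithSeq_length_add_one (a : List ℕ) : keithSeq a (a.length + 1) = a.sum := by
  simp [keithSeq_succ, keithList_eq_take]

theorem keithSeq_add_keithSeq (a : List ℕ) (ha : 1 ≤ a.length) (k : ℕ) :
    keithSeq a (a.length + k + 2) + keithSeq a (k + 1) = 2 * keithSeq a (a.length + k + 1) := by
  have hlen := length_keithList a (a.length + k)
  have h₁ : keithSeq a (a.length + k + 1) = ((keithList a (a.length + k)).drop k).sum := by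
    rw [keithSeq_succ, if_neg (by omega), Nat.add_sub_cancel_left]
  have h₂ : keithSeq a (a.length + k + 2) =
      ((keithList a (a.length + k)).drop (k + 1)).sum + keithSeq a (a.length + k + 1) := by
    rw [keithSeq_succ a (a.length + k + 1), if_neg (by omega), keithList_succ_eq_append_keithSeq,
      show a.length + k + 1 - a.length = k + 1 by omega,
      List.drop_append_of_le_length (by omega), List.sum_append, List.sum_singleton]
  have h₃ : ((keithList a (a.length + k)).drop k).sum =
      keithSeq a (k + 1) + ((keithList a (a.length + k)).drop (k + 1)).sum := by
    rw [List.drop_eq_getElem_cons (by omega), List.sum_cons,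
      ← getD_keithList a (show k < a.length + k by omega), List.getD_eq_getElem]
  omega

theorem keithSeq_replicate_one_of_lt {n k : ℕ} (h : k < n) :
    keithSeq (List.replicate n 1) (k + 1) = 1 := by
  simp [keithSeq_succ, h]

theorem keithSeq_replicate_one_add_one (n : ℕ) :
    keithSeq (List.replicate n 1) (n + 1) = n := by
  simpa using keithSeq_length_add_one (List.replicate n 1)

theorem keithSeq_replicate_one_add_keithSeq {n : ℕ} (hn : 1 ≤ n) (k : ℕ) :
    keithSeq (List.replicate n 1) (n + k + 2) + keithSeq (List.replicate n 1) (k + 1) =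
      2 * keithSeq (List.replicate n 1) (n + k + 1) := by
  simpa using keithSeq_add_keithSeq (List.replicate n 1) (by simpa) k

theorem one_le_keithSeq_replicate_one {n : ℕ} (hn : 1 ≤ n) (k : ℕ) :
    1 ≤ keithSeq (List.replicate n 1) (k + 1) := by
  have hmono : ∀ j, 1 ≤ keithSeq (List.replicate n 1) (n + j + 1) ∧
      ∀ i ≤ n + j, keithSeq (List.replicate n 1) (i + 1) ≤
        keithSeq (List.replicate n 1) (n + j + 1) := by
    intro j
    induction j with
    | zero =>
      rw [Nat.add_zero, keithSeq_replicate_one_add_one]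
      refine ⟨hn, fun i hi => ?_⟩
      rw [Nat.add_zero] at hi
      rcases hi.lt_or_eq with hi | rfl
      · rwa [keithSeq_replicate_one_of_lt hi]
      · rw [keithSeq_replicate_one_add_one]
    | succ j ih =>
      have hrec := keithSeq_replicate_one_add_keithSeq hn j
      have hj := ih.2 j (by omega)
      rw [show n + (j + 1) + 1 = n + j + 2 by ring]
      refine ⟨by omega, fun i hi => ?_⟩
      rcases hi.lt_or_eq with hi | rfl
      · have := ih.2 i (by omega)
        omega
      · rw [show n + (j + 1) + 1 = n + j + 2 by ring]
  rcases lt_or_ge k n with h | h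
  · rw [keithSeq_replicate_one_of_lt h]
  · obtain ⟨j, rfl⟩ := Nat.exists_eq_add_of_le h
    exact (hmono j).1

theorem keithSeq_replicate_one_le {n : ℕ} (hn : 1 ≤ n) (k : ℕ) :
    (keithSeq (List.replicate n 1) (n + k + 1) : ℝ) ≤ 2 ^ k * ((n : ℝ) - 1) + 1 := by
  induction k with
  | zero => simp [keithSeq_replicate_one_add_one]
  | succ k ih =>
    have hrec : (keithSeq (List.replicate n 1) (n + k + 2) : ℝ) +
        keithSeq (List.replicate n 1) (k + 1) =
          2 * keithSeq (List.replicate n 1) (n + k + 1) :=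
      mod_cast keithSeq_replicate_one_add_keithSeq hn k
    have hpos : (1 : ℝ) ≤ keithSeq (List.replicate n 1) (k + 1) :=
      mod_cast one_le_keithSeq_replicate_one hn k
    rw [show n + (k + 1) + 1 = n + k + 2 by ring, pow_succ]
    linarith

theorem keithSeq_replicate_one_le_zpow {n : ℕ} (hn : 1 ≤ n) (k : ℕ) :
    (keithSeq (List.replicate n 1) (k + 1) : ℝ) ≤
      2 ^ ((k : ℤ) - n) * ((n : ℝ) - 1) + 1 := by
  rcases lt_or_ge k n with h | h
  · have hn' : (0 : ℝ) ≤ (n : ℝ) - 1 := sub_nonneg.mpr (mod_cast hn)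
    rw [keithSeq_replicate_one_of_lt h, Nat.cast_one]
    exact le_add_of_nonneg_left (by positivity)
  · obtain ⟨j, rfl⟩ := Nat.exists_eq_add_of_le h
    simpa using keithSeq_replicate_one_le hn j

theorem lt_keithSeq_replicate_one {n : ℕ} (hn : 2 ≤ n) (k : ℕ) :
    2 ^ k * ((n : ℝ) - 1) + 1 -
        ((n + k + 1 : ℕ) : ℝ) * 2 ^ ((k : ℤ) + 1 - n) * ((n : ℝ) - 1) <
      keithSeq (List.replicate n 1) (n + k + 1) := by
  have hn' : (0 : ℝ) < (n : ℝ) - 1 := sub_pos.mpr (mod_cast hn)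
  induction k with
  | zero =>
    have : 0 < ((n + 0 + 1 : ℕ) : ℝ) * 2 ^ (((0 : ℕ) : ℤ) + 1 - n) * ((n : ℝ) - 1) := by
      positivity
    rw [Nat.add_zero, keithSeq_replicate_one_add_one]
    rw [Nat.add_zero] at this
    linarith
  | succ k ih =>
    have hrec : (keithSeq (List.replicate n 1) (n + k + 2) : ℝ) +
        keithSeq (List.replicate n 1) (k + 1) =
          2 * keithSeq (List.replicate n 1) (n + k + 1) :=
      mod_cast keithSeq_replicate_one_add_keithSeq (by omega) k
    have hle := keithSeq_replicate_one_le_zpow (show 1 ≤ n by omega) k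
    have hx : 0 < (2 : ℝ) ^ ((k : ℤ) - n) * ((n : ℝ) - 1) := by positivity
    have h₁ : (2 : ℝ) ^ ((k : ℤ) + 1 - n) = 2 ^ ((k : ℤ) - n) * 2 := by
      rw [← zpow_add_one₀ two_ne_zero]
      ring_nf
    have h₂ : (2 : ℝ) ^ (((k + 1 : ℕ) : ℤ) + 1 - n) = 2 ^ ((k : ℤ) - n) * 4 := by
      rw [show ((k + 1 : ℕ) : ℤ) + 1 - n = (k : ℤ) - n + 2 by push_cast; ring,
        zpow_add₀ two_ne_zero]
      norm_num
    rw [h₁] at ih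
    rw [h₂, show n + (k + 1) + 1 = n + k + 2 by ring, pow_succ]
    push_cast at ih ⊢
    linarith

/-- For fixed n ≥ 2 and every m ≥ n + 1,
2^{m−n−1}(n−1) + 1 − m·2^{m−2n}(n−1) < L^n_m ≤ 2^{m−n−1}(n−1) + 1,
i.e. the defect d(m) = 2^{m−n−1} − (L^n_m − 1)/(n−1) satisfies 0 ≤ d(m) < m·2^{m−2n}. -/
theorem L_asymptotics (n : ℕ) (hn : 2 ≤ n) (m : ℕ) (hm : n + 1 ≤ m) :
    (2 : ℝ) ^ (m - n - 1) * ((n : ℝ) - 1) + 1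
        - (m : ℝ) * (2 : ℝ) ^ ((m : ℤ) - 2 * (n : ℤ)) * ((n : ℝ) - 1)
      < (keithSeq (List.replicate n 1) m : ℝ) ∧
    (keithSeq (List.replicate n 1) m : ℝ)
      ≤ (2 : ℝ) ^ (m - n - 1) * ((n : ℝ) - 1) + 1 := by
  obtain ⟨k, rfl⟩ : ∃ k, m = n + k + 1 := ⟨m - n - 1, by omega⟩
  rw [show n + k + 1 - n - 1 = k by omega,
    show ((n + k + 1 : ℕ) : ℤ) - 2 * (n : ℤ) = (k : ℤ) + 1 - n by push_cast; ring]
  exact ⟨lt_keithSeq_replicate_one hn k, keithSeq_replicate_one_le (by omega) k⟩
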